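/- arXiv:1701.01026 — 11 statements merged into one kernel-verified Lean document; each statement's English description precedes it below -/
import Mathlib

section
/- For every u with -w ≤ u ≤ v_f, the convex transform of the triangular fundamental diagram satisfies sup_{k ∈ [0, k_j]} (Q(k) − u·k) = k_c·(v_f − u), and this supremum is attained at k = k_c. -/
open Set

/-- Convex transform of the triangular fundamental diagram:
for every `u ∈ [-w, v_f]`, `sup_{k ∈ [0, k_j]} (Q(k) − u·k) = k_c·(v_f − u)`,
attained at `k = k_c`. -/
theorem triangular_convex_transform
    (vf w kj : ℝ) (hvf : 0 < vf) (hw : 0 < w) (hkj : 0 < kj)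
    (kc : ℝ) (hkc : kc = w * kj / (vf + w))
    (u : ℝ) (hu1 : -w ≤ u) (hu2 : u ≤ vf) :
    IsGreatest ((fun k => min (vf * k) (w * (kj - k)) - u * k) '' Set.Icc 0 kj)
      (kc * (vf - u)) ∧
    min (vf * kc) (w * (kj - kc)) - u * kc = kc * (vf - u) := by
  have hs : 0 < vf + w := by linarith
  have h1 : kc * (vf + w) = w * kj := by rw [hkc]; field_simp
  have h2 : w * (kj - kc) = vf * kc := by linarith
  have h3 : min (vf * kc) (w * (kj - kc)) - u * kc = kc * (vf - u) := by
    rw [h2, min_self]; ring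
  have h0 : 0 ≤ kc := by rw [hkc]; positivity
  have h4 : kc ≤ kj := by
    by_contra! h
    nlinarith [mul_pos hw (sub_pos.2 h), mul_nonneg hvf.le h0]
  refine ⟨⟨⟨kc, ⟨h0, h4⟩, h3⟩, ?_⟩, h3⟩
  rintro _ ⟨k, _, rfl⟩
  show min (vf * k) (w * (kj - k)) - u * k ≤ kc * (vf - u)
  have ha := min_le_left (vf * k) (w * (kj - k))
  have hb := min_le_right (vf * k) (w * (kj - k))
  rcases le_total k kc with h | h
  · nlinarith [mul_nonneg (sub_nonneg.2 h) (sub_nonneg.2 hu2)]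
  · nlinarith [mul_nonneg (sub_nonneg.2 h) (sub_nonneg.2 hu1)]
end

section
/- Inf-morphism property: for any nonempty family (c_i)_{i ∈ I} of value-condition functions with values in the extended reals, and c := the pointwise infimum inf_{i ∈ I} c_i, the Lax–Hopf solutions satisfy N_c(t,x) = inf_{i ∈ I} N_{c_i}(t,x) for every (t,x) ∈ ℝ × ℝ. -/
open Set

noncomputable def laxHopf (vf w kc : ℝ) (c : ℝ → ℝ → EReal) (t x : ℝ) : EReal :=
  sInf {z : EReal | ∃ T u : ℝ, 0 ≤ T ∧ -w ≤ u ∧ u ≤ vf ∧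
    z = c (t - T) (x - T * u) + ((T * (kc * (vf - u)) : ℝ) : EReal)}

/-- Inf-morphism property: the Lax–Hopf solution associated with a pointwise
infimum of a nonempty family of value conditions is the pointwise infimum of
the corresponding solutions. -/
theorem laxHopf_inf_morphism
    (vf w kj : ℝ) (hvf : 0 < vf) (hw : 0 < w) (hkj : 0 < kj)
    (kc : ℝ) (hkc : kc = w * kj / (vf + w))
    {ι : Type*} [Nonempty ι] (c : ι → ℝ → ℝ → EReal) (t x : ℝ) :
    laxHopf vf w kc (fun τ y => ⨅ i, c i τ y) t x
      = ⨅ i, laxHopf vf w kc (c i) t x := by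
  apply le_antisymm
  · refine le_iInf fun i => le_sInf ?_
    rintro z ⟨T, u, hT, hu, hu', rfl⟩
    refine sInf_le_of_le ⟨T, u, hT, hu, hu', rfl⟩ ?_
    exact add_le_add (iInf_le _ i) le_rfl
  · refine le_sInf ?_
    rintro z ⟨T, u, hT, hu, hu', rfl⟩
    rw [← EReal.sub_le_iff_le_add (Or.inl (EReal.coe_ne_bot _)) (Or.inl (EReal.coe_ne_top _))]
    refine le_iInf fun i => ?_
    rw [EReal.sub_le_iff_le_add (Or.inl (EReal.coe_ne_bot _)) (Or.inl (EReal.coe_ne_top _))]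
    exact (iInf_le _ i).trans (sInf_le ⟨T, u, hT, hu, hu', rfl⟩)
end

section
/- Solution to a free-flow linear initial condition: let 0 ≤ κ ≤ k_c, x₁ < x₂ and b ∈ ℝ, and let c(t,x) := −κ·x + b if t = 0 and x₁ ≤ x ≤ x₂, and c(t,x) := +∞ otherwise. Then for every t > 0 and x ∈ ℝ: (i) if x₁ + t·v_f ≤ x ≤ x₂ + t·v_f, then N_c(t,x) = κ·(t·v_f − x) + b; (ii) if x₁ − t·w ≤ x ≤ x₁ + t·v_f, then N_c(t,x) = k_c·(t·v_f − x) + b + x₁·(k_c − κ). -/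
open Set

/-- Solution to a free-flow linear initial condition. -/
theorem laxHopf_initial_freeflow
    (vf w kj : ℝ) (hvf : 0 < vf) (hw : 0 < w) (hkj : 0 < kj)
    (kc : ℝ) (hkc : kc = w * kj / (vf + w))
    (κ x₁ x₂ b : ℝ) (hκ0 : 0 ≤ κ) (hκc : κ ≤ kc) (hx : x₁ < x₂)
    (c : ℝ → ℝ → EReal)
    (hc : c = fun t x => if t = 0 ∧ x₁ ≤ x ∧ x ≤ x₂
      then ((-κ * x + b : ℝ) : EReal) else ⊤)
    (t x : ℝ) (ht : 0 < t) :
    (x₁ + t * vf ≤ x → x ≤ x₂ + t * vf →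
      laxHopf vf w kc c t x = ((κ * (t * vf - x) + b : ℝ) : EReal)) ∧
    (x₁ - t * w ≤ x → x ≤ x₁ + t * vf →
      laxHopf vf w kc c t x = ((kc * (t * vf - x) + b + x₁ * (kc - κ) : ℝ) : EReal)) := by
  have key : ∀ y V : ℝ, x₁ ≤ y → y ≤ x₂ → x - t * vf ≤ y → y ≤ x + t * w →
      (∀ y', x₁ ≤ y' → x - t * vf ≤ y' → y ≤ y') →
      V = kc * (t * vf - x) + b + (kc - κ) * y →
      laxHopf vf w kc c t x = (V : EReal) := by
    intro y V h1 h2 h3 h4 hmin hV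
    have htne : t ≠ 0 := ht.ne'
    unfold laxHopf
    apply le_antisymm
    · apply sInf_le
      refine ⟨t, (x - y) / t, ht.le, ?_, ?_, ?_⟩
      · rw [le_div_iff₀ ht]; linarith
      · rw [div_le_iff₀ ht]; linarith
      · have e : t * ((x - y) / t) = x - y := by field_simp
        have e2 : t * (kc * (vf - (x - y) / t)) = kc * (t * vf - (x - y)) := by
          linear_combination (-kc) * e
        rw [e, e2, hc]
        have e3 : t - t = 0 ∧ x₁ ≤ x - (x - y) ∧ x - (x - y) ≤ x₂ :=
          ⟨by ring, by linarith, by linarith⟩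
        simp only [if_pos e3]
        rw [← EReal.coe_add, hV]
        congr 1
        ring
    · apply le_sInf
      rintro z ⟨T, u, hT, hu1, hu2, rfl⟩
      rw [hc]
      by_cases e3 : t - T = 0 ∧ x₁ ≤ x - T * u ∧ x - T * u ≤ x₂
      · simp only [if_pos e3]
        rw [← EReal.coe_add, EReal.coe_le_coe_iff, hV]
        obtain ⟨e, e1, e2⟩ := e3
        have hTt : T = t := by linarith
        subst hTt
        have hm := hmin (x - T * u) e1 (by nlinarith)
        have := mul_le_mul_of_nonneg_left hm (sub_nonneg.2 hκc)
        nlinarith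
      · simp only [if_neg e3]
        rw [EReal.top_add_coe]
        exact le_top
  have hp : 0 < t * w := mul_pos ht hw
  have hq : 0 < t * vf := mul_pos ht hvf
  constructor
  · intro h1 h2
    exact key (x - t * vf) _ (by linarith) (by linarith) le_rfl (by linarith)
      (fun y' _ h => h) (by ring)
  · intro h1 h2
    exact key x₁ _ le_rfl hx.le (by linarith) (by linarith)
      (fun y' h _ => h) (by ring)
end

section
/- Solution to a congested linear initial condition: let k_c ≤ κ ≤ k_j, x₁ < x₂ and b ∈ ℝ, and let c(t,x) := −κ·x + b if t = 0 and x₁ ≤ x ≤ x₂, and c(t,x) := +∞ otherwise. Then for every t > 0 and x ∈ ℝ: (i) if x₁ − t·w ≤ x ≤ x₂ − t·w, then N_c(t,x) = −κ·(x + t·w) + t·k_j·w + b; (ii) if x₂ − t·w ≤ x ≤ x₂ + t·v_f, then N_c(t,x) = k_c·(t·v_f − x) + b + x₂·(k_c − κ). -/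
open Set

/-- Solution to a congested linear initial condition. -/
theorem laxHopf_initial_congested
    (vf w kj : ℝ) (hvf : 0 < vf) (hw : 0 < w) (hkj : 0 < kj)
    (kc : ℝ) (hkc : kc = w * kj / (vf + w))
    (κ x₁ x₂ b : ℝ) (hκc : kc ≤ κ) (hκj : κ ≤ kj) (hx : x₁ < x₂)
    (c : ℝ → ℝ → EReal)
    (hc : c = fun t x => if t = 0 ∧ x₁ ≤ x ∧ x ≤ x₂
      then ((-κ * x + b : ℝ) : EReal) else ⊤)
    (t x : ℝ) (ht : 0 < t) :
    (x₁ - t * w ≤ x → x ≤ x₂ - t * w →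
      laxHopf vf w kc c t x = ((-κ * (x + t * w) + t * kj * w + b : ℝ) : EReal)) ∧
    (x₂ - t * w ≤ x → x ≤ x₂ + t * vf →
      laxHopf vf w kc c t x = ((kc * (t * vf - x) + b + x₂ * (kc - κ) : ℝ) : EReal)) := by
  have hk : kc * (vf + w) = w * kj := by
    rw [hkc]; field_simp
  have key : ∀ u₀ V : ℝ, -w ≤ u₀ → u₀ ≤ vf → x₁ ≤ x - t * u₀ → x - t * u₀ ≤ x₂ →
      V = -κ * (x - t * u₀) + b + t * (kc * (vf - u₀)) →
      (∀ u : ℝ, -w ≤ u → x - t * u ≤ x₂ → x - t * u ≤ x - t * u₀) →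
      laxHopf vf w kc c t x = (V : EReal) := by
    intro u₀ V h1 h2 h3 h4 hV hmax
    apply le_antisymm
    · apply sInf_le
      refine ⟨t, u₀, ht.le, h1, h2, ?_⟩
      rw [hc]
      simp only [sub_self, true_and]
      rw [if_pos ⟨h3, h4⟩, hV, EReal.coe_add]
    · apply le_sInf
      rintro z ⟨T, u, hT, hu1, hu2, rfl⟩
      rw [hc]
      dsimp only
      split_ifs with h
      · obtain ⟨h0, -, hb⟩ := h
        have hTt : T = t := by linarith
        subst hTt
        rw [← EReal.coe_add, EReal.coe_le_coe_iff, hV]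
        have := hmax u hu1 hb
        nlinarith [mul_nonneg (sub_nonneg.2 hκc) (sub_nonneg.2 this)]
      · rw [EReal.top_add_coe]
        exact le_top
  constructor
  · intro h1 h2
    apply key (-w) _ le_rfl (by linarith) (by linarith) (by linarith)
    · linear_combination (-t) * hk
    · intro u hu _
      nlinarith
  · intro h1 h2
    have e : t * ((x - x₂) / t) = x - x₂ := by field_simp
    apply key ((x - x₂) / t)
    · rw [le_div_iff₀ ht]; linarith
    · rw [div_le_iff₀ ht]; linarith
    · rw [e]; linarith
    · rw [e]; linarith
    · linear_combination (kc - κ) * e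
    · intro u _ hu
      rw [e]; linarith
end

section
/- Solution to a linear upstream boundary condition: let x₀ ∈ ℝ, t₁ < t₂, 0 ≤ q ≤ k_c·v_f and d ∈ ℝ, and let c(t,x) := q·t + d if x = x₀ and t₁ ≤ t ≤ t₂, and c(t,x) := +∞ otherwise. Then for every (t,x) with x ≥ x₀: (i) if x₀ + v_f·(t−t₂) ≤ x ≤ x₀ + v_f·(t−t₁), then N_c(t,x) = d + q·(t − (x−x₀)/v_f); (ii) if x₀ ≤ x ≤ x₀ + v_f·(t−t₂), then N_c(t,x) = d + q·t₂ + k_c·((t−t₂)·v_f − (x−x₀)). -/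
open Set

theorem laxHopf_aux (vf w kc x₀ t₁ t₂ q d t x S u : ℝ) (hq : q ≤ kc * vf)
    (c : ℝ → ℝ → EReal)
    (hc : c = fun t x => if x = x₀ ∧ t₁ ≤ t ∧ t ≤ t₂
      then ((q * t + d : ℝ) : EReal) else ⊤)
    (h1 : t₁ ≤ S) (h2 : S ≤ t₂) (hT : 0 ≤ t - S) (hu : (t - S) * u = x - x₀)
    (hu1 : -w ≤ u) (hu2 : u ≤ vf)
    (hmax : ∀ s, s ≤ t₂ → x - x₀ ≤ (t - s) * vf → s ≤ S) :
    laxHopf vf w kc c t x = ((q * S + d + kc * (vf * (t - S) - (x - x₀)) : ℝ) : EReal) := by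
  subst hc
  apply le_antisymm
  · apply sInf_le
    refine ⟨t - S, u, hT, hu1, hu2, ?_⟩
    have e : x - (t - S) * u = x₀ ∧ t₁ ≤ t - (t - S) ∧ t - (t - S) ≤ t₂ :=
      ⟨by linarith, by linarith, by linarith⟩
    simp only [if_pos e]
    rw [← EReal.coe_add, EReal.coe_eq_coe_iff, ← hu]
    ring
  · apply le_sInf
    rintro z ⟨T, v, hT0, hv1, hv2, rfl⟩
    by_cases e : x - T * v = x₀ ∧ t₁ ≤ t - T ∧ t - T ≤ t₂
    · simp only [if_pos e]
      rw [← EReal.coe_add, EReal.coe_le_coe_iff]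
      obtain ⟨e1, e2, e3⟩ := e
      have hx : x - x₀ = T * v := by linarith
      have h := hmax (t - T) e3 (by
        rw [hx]; have := mul_le_mul_of_nonneg_left hv2 hT0; linarith)
      rw [hx]
      nlinarith [mul_nonneg (sub_nonneg.2 hq) (sub_nonneg.2 h)]
    · simp only [if_neg e]
      rw [EReal.top_add_coe]; exact le_top

/-- Solution to a linear upstream boundary condition. -/
theorem laxHopf_upstream
    (vf w kj : ℝ) (hvf : 0 < vf) (hw : 0 < w) (hkj : 0 < kj)
    (kc : ℝ) (hkc : kc = w * kj / (vf + w))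
    (x₀ t₁ t₂ q d : ℝ) (ht : t₁ < t₂) (hq0 : 0 ≤ q) (hq : q ≤ kc * vf)
    (c : ℝ → ℝ → EReal)
    (hc : c = fun t x => if x = x₀ ∧ t₁ ≤ t ∧ t ≤ t₂
      then ((q * t + d : ℝ) : EReal) else ⊤)
    (t x : ℝ) (hx0 : x₀ ≤ x) :
    (x₀ + vf * (t - t₂) ≤ x → x ≤ x₀ + vf * (t - t₁) →
      laxHopf vf w kc c t x = ((d + q * (t - (x - x₀) / vf) : ℝ) : EReal)) ∧
    (x₀ ≤ x → x ≤ x₀ + vf * (t - t₂) →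
      laxHopf vf w kc c t x
        = ((d + q * t₂ + kc * ((t - t₂) * vf - (x - x₀)) : ℝ) : EReal)) := by
  constructor
  · intro h1 h2
    have hT : 0 ≤ (x - x₀) / vf := div_nonneg (by linarith) hvf.le
    have hm : (x - x₀) / vf * vf = x - x₀ := div_mul_cancel₀ _ hvf.ne'
    have ha : (x - x₀) / vf ≤ t - t₁ := by rw [div_le_iff₀ hvf]; linarith
    have hb : t - t₂ ≤ (x - x₀) / vf := by rw [le_div_iff₀ hvf]; linarith
    rw [laxHopf_aux vf w kc x₀ t₁ t₂ q d t x (t - (x - x₀) / vf) vf hq c hc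
      (by linarith) (by linarith) (by linarith) (by linarith) (by linarith) le_rfl
      (fun s _ h => by rw [← div_le_iff₀ hvf] at h; linarith)]
    rw [EReal.coe_eq_coe_iff]
    have : vf * (t - (t - (x - x₀) / vf)) - (x - x₀) = 0 := by linarith
    rw [this]; ring
  · intro _ h2
    have hT : 0 ≤ t - t₂ := by
      by_contra h
      push Not at h
      nlinarith
    have : ∃ u, (t - t₂) * u = x - x₀ ∧ -w ≤ u ∧ u ≤ vf := by
      rcases hT.eq_or_lt with h | h
      · rw [← h] at h2 ⊢
        exact ⟨vf, by linarith, by linarith, le_rfl⟩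
      · refine ⟨(x - x₀) / (t - t₂), mul_div_cancel₀ _ h.ne', ?_, ?_⟩
        · have : 0 ≤ (x - x₀) / (t - t₂) := div_nonneg (by linarith) hT
          linarith
        · rw [div_le_iff₀ h]; linarith
    obtain ⟨u, hu, hu1, hu2⟩ := this
    rw [laxHopf_aux vf w kc x₀ t₁ t₂ q d t x t₂ u hq c hc ht.le le_rfl hT hu hu1 hu2
      (fun s h _ => h)]
    rw [EReal.coe_eq_coe_iff]
    ring
end

section
/- Solution to a linear downstream boundary condition: let x_n ∈ ℝ, t₁ < t₂, 0 ≤ p ≤ k_c·v_f and b ∈ ℝ, and let c(t,x) := p·t + b if x = x_n and t₁ ≤ t ≤ t₂, and c(t,x) := +∞ otherwise. Then for every (t,x) with x ≤ x_n: (i) if x_n − w·(t−t₁) ≤ x ≤ x_n − w·(t−t₂), then N_c(t,x) = b + p·(t − (x_n − x)/w) + k_j·(x_n − x); (ii) if x_n − w·(t−t₂) ≤ x ≤ x_n, then N_c(t,x) = b + p·t₂ + k_c·((t−t₂)·v_f + x_n − x). -/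
open Set

/-- Solution to a linear downstream boundary condition. -/
theorem laxHopf_downstream
    (vf w kj : ℝ) (hvf : 0 < vf) (hw : 0 < w) (hkj : 0 < kj)
    (kc : ℝ) (hkc : kc = w * kj / (vf + w))
    (xn t₁ t₂ p b : ℝ) (ht : t₁ < t₂) (hp0 : 0 ≤ p) (hp : p ≤ kc * vf)
    (c : ℝ → ℝ → EReal)
    (hc : c = fun t x => if x = xn ∧ t₁ ≤ t ∧ t ≤ t₂
      then ((p * t + b : ℝ) : EReal) else ⊤)
    (t x : ℝ) (hxn : x ≤ xn) :
    (xn - w * (t - t₁) ≤ x → x ≤ xn - w * (t - t₂) →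
      laxHopf vf w kc c t x
        = ((b + p * (t - (xn - x) / w) + kj * (xn - x) : ℝ) : EReal)) ∧
    (xn - w * (t - t₂) ≤ x → x ≤ xn →
      laxHopf vf w kc c t x
        = ((b + p * t₂ + kc * ((t - t₂) * vf + xn - x) : ℝ) : EReal)) := by
  have hs : 0 < vf + w := by linarith
  have hk : kc * (vf + w) = w * kj := by rw [hkc]; field_simp
  have key : ∀ T₀ u₀ V : ℝ, 0 ≤ T₀ → -w ≤ u₀ → u₀ ≤ vf → x - T₀ * u₀ = xn →
      t₁ ≤ t - T₀ → t - T₀ ≤ t₂ →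
      V = p * (t - T₀) + b + T₀ * (kc * (vf - u₀)) →
      (∀ T : ℝ, 0 ≤ T → xn - x ≤ w * T → t - T ≤ t₂ → T₀ ≤ T) →
      laxHopf vf w kc c t x = (V : EReal) := by
    intro T₀ u₀ V hT hu1 hu2 hx h1 h2 hV hmin
    apply le_antisymm
    · apply sInf_le
      refine ⟨T₀, u₀, hT, hu1, hu2, ?_⟩
      rw [hc]
      simp only [if_pos (And.intro hx (And.intro h1 h2))]
      rw [hV, EReal.coe_add (p * (t - T₀) + b)]
    · apply le_sInf
      rintro z ⟨T, u, hT', hu1', hu2', rfl⟩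
      rw [hc]
      by_cases h : x - T * u = xn ∧ t₁ ≤ t - T ∧ t - T ≤ t₂
      · simp only [if_pos h]
        obtain ⟨ha, hb, hd⟩ := h
        rw [← EReal.coe_add, EReal.coe_le_coe_iff, hV]
        have hle : T₀ ≤ T := hmin T hT' (by nlinarith) hd
        have e1 : T * u = T₀ * u₀ := by linarith
        have e2 : kc * (T * u) = kc * (T₀ * u₀) := by rw [e1]
        nlinarith [mul_nonneg (sub_nonneg.2 hle) (sub_nonneg.2 hp)]
      · simp only [if_neg h]
        rw [EReal.top_add_coe]
        exact le_top
  constructor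
  · intro hA hB
    have hwd : w * ((xn - x) / w) = xn - x := by field_simp
    have hd0 : 0 ≤ (xn - x) / w := div_nonneg (by linarith) hw.le
    refine key ((xn - x) / w) (-w) _ hd0 le_rfl (by linarith) (by linarith) ?_ ?_ ?_ ?_
    · have : (xn - x) / w ≤ t - t₁ := by rw [div_le_iff₀ hw]; linarith
      linarith
    · have : t - t₂ ≤ (xn - x) / w := by rw [le_div_iff₀ hw]; linarith
      linarith
    · have e : (xn - x) / w * (kc * (vf - -w)) = kj * (xn - x) := by
        rw [sub_neg_eq_add, hk, ← hwd]; field_simp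
      rw [e]; ring
    · intro T _ h _
      rw [div_le_iff₀ hw]; linarith
  · intro hA _
    have hT : 0 ≤ t - t₂ := by
      by_contra hn
      nlinarith [mul_pos hw (sub_pos.2 (not_le.1 hn))]
    have hex : ∃ u, -w ≤ u ∧ u ≤ 0 ∧ (t - t₂) * u = x - xn := by
      rcases hT.eq_or_lt with h0 | h0
      · refine ⟨0, by linarith, le_rfl, ?_⟩
        rw [← h0] at hA
        linarith
      · refine ⟨(x - xn) / (t - t₂), ?_, ?_, ?_⟩
        · rw [le_div_iff₀ h0]; linarith
        · exact div_nonpos_of_nonpos_of_nonneg (by linarith) h0.le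
        · field_simp
    obtain ⟨u, hu1, hu2, hu⟩ := hex
    refine key (t - t₂) u _ hT hu1 (by linarith) (by linarith) (by linarith) (by linarith) ?_ ?_
    · linear_combination kc * hu
    · intro T _ _ h
      linarith
end

section
/- Solution downstream of a moving-bottleneck internal condition: for the internal condition c with parameters (t_b, t_e, x_b, s, r, N_b) where additionally −w < s < v_f, let (t,x) ∈ ℝ × ℝ and set t' := t − (x − x_b − s·(t − t_b))/(v_f − s). If t_b ≤ t' and t' ≤ t and t' ≤ t_e, then N_c(t,x) = N_b + r·(t' − t_b). -/
open Set

/-- Solution downstream of a moving-bottleneck internal condition. -/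
theorem laxHopf_internal_downstream
    (vf w kj : ℝ) (hvf : 0 < vf) (hw : 0 < w) (hkj : 0 < kj)
    (kc : ℝ) (hkc : kc = w * kj / (vf + w))
    (tb te xb s r Nb : ℝ) (hte : tb < te)
    (hs1 : -w < s) (hs2 : s < vf) (hr0 : 0 ≤ r) (hr : r ≤ kc * (vf - s))
    (c : ℝ → ℝ → EReal)
    (hc : c = fun τ y => if tb ≤ τ ∧ τ ≤ te ∧ y = xb + s * (τ - tb)
      then ((Nb + r * (τ - tb) : ℝ) : EReal) else ⊤)
    (t x t' : ℝ)
    (ht' : t' = t - (x - xb - s * (t - tb)) / (vf - s))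
    (h1 : tb ≤ t') (h2 : t' ≤ t) (h3 : t' ≤ te) :
    laxHopf vf w kc c t x = ((Nb + r * (t' - tb) : ℝ) : EReal) := by
  have hd : 0 < vf - s := by linarith
  have hx : (vf - s) * (t - t') = x - xb - s * (t - tb) := by
    rw [ht']; field_simp; ring
  unfold laxHopf
  apply le_antisymm
  · apply sInf_le
    refine ⟨t - t', vf, by linarith, by linarith, le_rfl, ?_⟩
    have e1 : t - (t - t') = t' := by ring
    have e2 : x - (t - t') * vf = xb + s * (t' - tb) := by linarith
    rw [hc, e1, e2]
    simp [h1, h3]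
  · apply le_sInf
    rintro z ⟨T, u, hT, hu1, hu2, rfl⟩
    rw [hc]
    dsimp only
    split_ifs with h
    · obtain ⟨ha, hb, hy⟩ := h
      rw [← EReal.coe_add, EReal.coe_le_coe_iff]
      have k1 : T * (vf - u) = (vf - s) * (t' - (t - T)) := by linarith
      have k2 : 0 ≤ (vf - s) * (t' - (t - T)) := by
        rw [← k1]; exact mul_nonneg hT (by linarith)
      have k3 : 0 ≤ t' - (t - T) := nonneg_of_mul_nonneg_right k2 hd
      have k4 := mul_le_mul_of_nonneg_right hr k3
      have k5 : T * (kc * (vf - u)) = kc * (vf - s) * (t' - (t - T)) := by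
        linear_combination kc * k1
      rw [k5]
      linarith
    · rw [EReal.top_add_coe]
      exact le_top
end

section
/- Solution in the expansion fan beyond the end of a moving-bottleneck internal condition: for the internal condition c with parameters (t_b, t_e, x_b, s, r, N_b) where additionally −w < s < v_f, set x_e := x_b + s·(t_e − t_b) and N_e := N_b + r·(t_e − t_b). If t > t_e and x_e − w·(t − t_e) ≤ x ≤ x_e + v_f·(t − t_e), then N_c(t,x) = N_e + k_c·(v_f·(t − t_e) − (x − x_e)). -/
open Set

/-- Solution in the expansion fan beyond the end of a moving-bottleneck
internal condition. -/
theorem laxHopf_internal_fan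
    (vf w kj : ℝ) (hvf : 0 < vf) (hw : 0 < w) (hkj : 0 < kj)
    (kc : ℝ) (hkc : kc = w * kj / (vf + w))
    (tb te xb s r Nb : ℝ) (hte : tb < te)
    (hs1 : -w < s) (hs2 : s < vf) (hr0 : 0 ≤ r) (hr : r ≤ kc * (vf - s))
    (c : ℝ → ℝ → EReal)
    (hc : c = fun τ y => if tb ≤ τ ∧ τ ≤ te ∧ y = xb + s * (τ - tb)
      then ((Nb + r * (τ - tb) : ℝ) : EReal) else ⊤)
    (xe Ne : ℝ) (hxe : xe = xb + s * (te - tb)) (hNe : Ne = Nb + r * (te - tb))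
    (t x : ℝ) (ht : te < t)
    (h1 : xe - w * (t - te) ≤ x) (h2 : x ≤ xe + vf * (t - te)) :
    laxHopf vf w kc c t x
      = ((Ne + kc * (vf * (t - te) - (x - xe)) : ℝ) : EReal) := by
  subst hc
  unfold laxHopf
  apply le_antisymm
  · have hT : 0 < t - te := by linarith
    have hu : (t - te) * ((x - xe) / (t - te)) = x - xe := by field_simp
    apply sInf_le
    refine ⟨t - te, (x - xe) / (t - te), hT.le, ?_, ?_, ?_⟩
    · rw [le_div_iff₀ hT]; linarith
    · rw [div_le_iff₀ hT]; linarith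
    · have e1 : t - (t - te) = te := by ring
      have e2 : x - (x - xe) = xe := by ring
      have e3 : (t - te) * (kc * (vf - (x - xe) / (t - te)))
          = kc * (vf * (t - te) - (x - xe)) := by
        linear_combination (-kc) * hu
      rw [e3, hu, e1, e2]
      dsimp only
      rw [if_pos ⟨hte.le, le_refl _, hxe⟩, ← EReal.coe_add, hNe]
  · apply le_sInf
    rintro z ⟨T, u, hT, hu1, hu2, rfl⟩
    dsimp only
    split_ifs with h
    · obtain ⟨ha, hb, hy⟩ := h
      rw [← EReal.coe_add, EReal.coe_le_coe_iff]
      have key : 0 ≤ (te - (t - T)) * (kc * (vf - s) - r) :=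
        mul_nonneg (by linarith) (by linarith)
      have hTu : T * u = x - xb - s * (t - T - tb) := by linarith
      have e : T * (kc * (vf - u)) = kc * (vf * T - (x - xb - s * (t - T - tb))) := by
        linear_combination (-kc) * hTu
      rw [e, hNe, hxe]
      linarith
    · rw [EReal.top_add_coe]
      exact le_top
end

section
/- Solution upstream of a moving-bottleneck internal condition (congested region): for the internal condition c with parameters (t_b, t_e, x_b, s, r, N_b) where additionally −w < s < v_f, let (t,x) ∈ ℝ × ℝ and set t' := t − (x_b + s·(t − t_b) − x)/(s + w). If t_b ≤ t' and t' ≤ t and t' ≤ t_e, then N_c(t,x) = N_b + r·(t' − t_b) + k_c·(v_f + w)·(t − t'). -/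
open Set

/-- Solution upstream of a moving-bottleneck internal condition
(congested region). -/
theorem laxHopf_internal_upstream
    (vf w kj : ℝ) (hvf : 0 < vf) (hw : 0 < w) (hkj : 0 < kj)
    (kc : ℝ) (hkc : kc = w * kj / (vf + w))
    (tb te xb s r Nb : ℝ) (hte : tb < te)
    (hs1 : -w < s) (hs2 : s < vf) (hr0 : 0 ≤ r) (hr : r ≤ kc * (vf - s))
    (c : ℝ → ℝ → EReal)
    (hc : c = fun τ y => if tb ≤ τ ∧ τ ≤ te ∧ y = xb + s * (τ - tb)
      then ((Nb + r * (τ - tb) : ℝ) : EReal) else ⊤)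
    (t x t' : ℝ)
    (ht' : t' = t - (xb + s * (t - tb) - x) / (s + w))
    (h1 : tb ≤ t') (h2 : t' ≤ t) (h3 : t' ≤ te) :
    laxHopf vf w kc c t x
      = ((Nb + r * (t' - tb) + kc * (vf + w) * (t - t') : ℝ) : EReal) := by
  have hsw : 0 < s + w := by linarith
  have hD : (t - t') * (s + w) = xb + s * (t - tb) - x := by
    rw [ht']; field_simp; ring
  unfold laxHopf
  apply le_antisymm
  · apply sInf_le
    refine ⟨t - t', -w, by linarith, le_refl _, by linarith, ?_⟩
    rw [hc]
    have hcond : tb ≤ t - (t - t') ∧ t - (t - t') ≤ te ∧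
        x - (t - t') * -w = xb + s * (t - (t - t') - tb) :=
      ⟨by linarith, by linarith, by linarith⟩
    simp only [if_pos hcond]
    rw [← EReal.coe_add]
    congr 1
    ring
  · apply le_sInf
    rintro z ⟨T, u, hT, hu1, hu2, rfl⟩
    rw [hc]
    by_cases hcond : tb ≤ t - T ∧ t - T ≤ te ∧ x - T * u = xb + s * (t - T - tb)
    · simp only [if_pos hcond]
      rw [← EReal.coe_add, EReal.coe_le_coe_iff]
      obtain ⟨-, -, h⟩ := hcond
      have e : T * u = T * s - (t - t') * (s + w) := by linarith
      have hle : t - t' ≤ T := by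
        have : (t - t') * (s + w) ≤ T * (s + w) := by nlinarith
        exact le_of_mul_le_mul_right this hsw
      have hm : 0 ≤ (T - (t - t')) * (kc * (vf - s) - r) :=
        mul_nonneg (by linarith) (by linarith)
      have e2 : T * (kc * (vf - u)) = kc * (T * vf - (T * s - (t - t') * (s + w))) := by
        rw [← e]; ring
      rw [e2]
      linarith
    · simp only [if_neg hcond]
      rw [EReal.top_add_coe]
      exact le_top
end

section
/- Domain of influence of a moving bottleneck: for the internal condition c with parameters (t_b, t_e, x_b, s, r, N_b), the Lax–Hopf solution satisfies N_c(t,x) < +∞ if and only if t ≥ t_b and x_b − w·(t − t_b) ≤ x ≤ x_b + v_f·(t − t_b). -/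
open Set

/-- Domain of influence of a moving bottleneck. -/
theorem laxHopf_internal_domain
    (vf w kj : ℝ) (hvf : 0 < vf) (hw : 0 < w) (hkj : 0 < kj)
    (kc : ℝ) (hkc : kc = w * kj / (vf + w))
    (tb te xb s r Nb : ℝ) (hte : tb < te)
    (hs1 : -w ≤ s) (hs2 : s ≤ vf) (hr0 : 0 ≤ r) (hr : r ≤ kc * (vf - s))
    (c : ℝ → ℝ → EReal)
    (hc : c = fun τ y => if tb ≤ τ ∧ τ ≤ te ∧ y = xb + s * (τ - tb)
      then ((Nb + r * (τ - tb) : ℝ) : EReal) else ⊤)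
    (t x : ℝ) :
    laxHopf vf w kc c t x < ⊤ ↔
      tb ≤ t ∧ xb - w * (t - tb) ≤ x ∧ x ≤ xb + vf * (t - tb) := by
  unfold laxHopf
  rw [sInf_lt_iff]
  constructor
  · rintro ⟨z, ⟨T, u, hT, hu1, hu2, rfl⟩, hz⟩
    by_cases h : tb ≤ t - T ∧ t - T ≤ te ∧ x - T * u = xb + s * (t - T - tb)
    · obtain ⟨h1, h2, h3⟩ := h
      have a1 := mul_nonneg hT (sub_nonneg.2 hu1)
      have a2 := mul_nonneg hT (sub_nonneg.2 hu2)
      have a3 := mul_nonneg (sub_nonneg.2 h1) (sub_nonneg.2 hs1)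
      have a4 := mul_nonneg (sub_nonneg.2 h1) (sub_nonneg.2 hs2)
      refine ⟨by linarith, by linarith, by linarith⟩
    · exfalso
      rw [hc] at hz
      simp only [if_neg h] at hz
      rw [EReal.top_add_coe] at hz
      exact lt_irrefl _ hz
  · rintro ⟨h1, h2, h3⟩
    have key : ∃ u : ℝ, -w ≤ u ∧ u ≤ vf ∧ x - (t - tb) * u = xb := by
      rcases h1.eq_or_lt with h | h
      · subst h
        exact ⟨0, by linarith, by linarith, by linarith⟩
      · have hp : 0 < t - tb := by linarith
        refine ⟨(x - xb) / (t - tb), ?_, ?_, ?_⟩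
        · rw [le_div_iff₀ hp]; linarith
        · rw [div_le_iff₀ hp]; linarith
        · rw [mul_div_cancel₀ _ hp.ne']; ring
    obtain ⟨u, hu1, hu2, hu⟩ := key
    refine ⟨_, ⟨t - tb, u, by linarith, hu1, hu2, rfl⟩, ?_⟩
    have h : tb ≤ t - (t - tb) ∧ t - (t - tb) ≤ te ∧
        x - (t - tb) * u = xb + s * (t - (t - tb) - tb) := by
      refine ⟨by linarith, by linarith, ?_⟩
      rw [hu]; ring
    rw [hc]
    simp only [if_pos h]
    rw [← EReal.coe_add]
    exact EReal.coe_lt_top _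
end

section
/- Domain of influence of a linear initial-condition block: let 0 ≤ κ ≤ k_j, x₁ < x₂ and b ∈ ℝ, and let c(t,x) := −κ·x + b if t = 0 and x₁ ≤ x ≤ x₂, and c(t,x) := +∞ otherwise. Then for every t ≥ 0 and x ∈ ℝ, the Lax–Hopf solution satisfies N_c(t,x) < +∞ if and only if x₁ − t·w ≤ x ≤ x₂ + t·v_f. -/
open Set

/-- Domain of influence of a linear initial-condition block. -/
theorem laxHopf_initial_domain
    (vf w kj : ℝ) (hvf : 0 < vf) (hw : 0 < w) (hkj : 0 < kj)
    (kc : ℝ) (hkc : kc = w * kj / (vf + w))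
    (κ x₁ x₂ b : ℝ) (hκ0 : 0 ≤ κ) (hκj : κ ≤ kj) (hx : x₁ < x₂)
    (c : ℝ → ℝ → EReal)
    (hc : c = fun t x => if t = 0 ∧ x₁ ≤ x ∧ x ≤ x₂
      then ((-κ * x + b : ℝ) : EReal) else ⊤)
    (t x : ℝ) (ht : 0 ≤ t) :
    laxHopf vf w kc c t x < ⊤ ↔ x₁ - t * w ≤ x ∧ x ≤ x₂ + t * vf := by
  subst hc
  unfold laxHopf
  rw [sInf_lt_iff]
  constructor
  · rintro ⟨z, ⟨T, u, hT, hu1, hu2, rfl⟩, hz⟩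
    by_cases h : t - T = 0 ∧ x₁ ≤ x - T * u ∧ x - T * u ≤ x₂
    · obtain ⟨h0, h1, h2⟩ := h
      have hTt : T = t := by linarith
      subst hTt
      constructor <;> nlinarith
    · simp only [if_neg h, EReal.top_add_coe, lt_irrefl] at hz
  · rintro ⟨h1, h2⟩
    have key : ∃ u : ℝ, -w ≤ u ∧ u ≤ vf ∧ x₁ ≤ x - t * u ∧ x - t * u ≤ x₂ := by
      rcases ht.eq_or_lt with h0 | h0
      · subst h0
        exact ⟨0, by linarith, by linarith, by linarith, by linarith⟩
      · have e : t * ((x - x₂) / t) = x - x₂ := by field_simp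
        rcases le_total (-w) ((x - x₂) / t) with h | h
        · refine ⟨(x - x₂) / t, h, ?_, by linarith, by linarith⟩
          rw [div_le_iff₀ h0]
          linarith
        · refine ⟨-w, le_refl _, by linarith, by linarith, ?_⟩
          rw [div_le_iff₀ h0] at h
          linarith
    obtain ⟨u, hu1, hu2, hu3, hu4⟩ := key
    refine ⟨_, ⟨t, u, ht, hu1, hu2, rfl⟩, ?_⟩
    have h : t - t = 0 ∧ x₁ ≤ x - t * u ∧ x - t * u ≤ x₂ := ⟨sub_self t, hu3, hu4⟩
    simp only [if_pos h]
    rw [← EReal.coe_add]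
    exact EReal.coe_lt_top _
end
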